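/- Under assumptions (H) on the perturbed dynamical system, there exists a > 0 (any a with 1/a < p − 1 works) such that, taking ψ₁(x) = exp(a|x|), the Feynman–Kac semigroup (P_n)_{n∈ℕ} satisfies Condition (G): there exist constants 0 < θ₁ < θ₂, c₁, c₂, c₃ > 0, an integer n₁ ≥ 1, a measurable function ψ₂ : E → [0,∞) with ψ₂ ≤ ψ₁, a measurable set K ⊆ E and a probability measure ν on K such that (G1) for all x ∈ K and measurable A ⊆ K, P_{n₁}(ψ₁ 1_A)(x) ≥ c₁ ν(A) ψ₁(x); (G2) inf_{x∈K} ψ₂(x)/ψ₁(x) > 0, P_1 ψ₁ ≤ θ₁ ψ₁ + c₂ 1_K ψ₁ on E, and P_1 ψ₂ ≥ θ₂ ψ₂ on E; (G3) sup_{n≥0} (sup_{y∈K} P_n ψ₁(y)/ψ₁(y)) / (inf_{y∈K} P_n ψ₁(y)/ψ₁(y)) ≤ c₃; (G4) for all x ∈ K there exists n₄(x) such that P_n(1_K ψ₁)(x) > 0 for all n ≥ n₄(x). -/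

import Mathlib

open MeasureTheory Set

noncomputable section

variable {d : ℕ}

/-- The law of a (possibly non-centered) nondegenerate Gaussian random vector on `ℝ^d`:
it has a density with mean `m` and positive-definite covariance matrix `Cov` with
respect to the Lebesgue measure. -/
def IsNondegGaussian (γ : Measure (EuclideanSpace ℝ (Fin d))) : Prop :=
  ∃ (m : EuclideanSpace ℝ (Fin d)) (Cov : Matrix (Fin d) (Fin d) ℝ), Cov.PosDef ∧
    γ = volume.withDensity (fun z => ENNReal.ofReal
      ((Real.sqrt ((2 * Real.pi) ^ d * Cov.det))⁻¹ *
        Real.exp (-(∑ i, ∑ j, (z i - m i) * Cov⁻¹ i j * (z j - m j)) / 2)))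

/-- One step of the Feynman–Kac semigroup associated with the perturbed dynamical
system `X_{n+1} = F(X_n) + ξ_n` (noise law `γ`), penalization `G` and domain `Edom`:
`P_1 f(x) = ∫ G(F(x)+z) 1_{Edom}(F(x)+z) f(F(x)+z) γ(dz)`. -/
def FKstep (Edom : Set (EuclideanSpace ℝ (Fin d)))
    (F : EuclideanSpace ℝ (Fin d) → EuclideanSpace ℝ (Fin d))
    (G : EuclideanSpace ℝ (Fin d) → ℝ) (γ : Measure (EuclideanSpace ℝ (Fin d)))
    (f : EuclideanSpace ℝ (Fin d) → ℝ) (x : EuclideanSpace ℝ (Fin d)) : ℝ :=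
  ∫ z, Edom.indicator (fun y => G y * f y) (F x + z) ∂γ

/-- The Feynman–Kac semigroup: `P_0 = Id`, `P_n = (P_1)^n`. -/
def FK (Edom : Set (EuclideanSpace ℝ (Fin d)))
    (F : EuclideanSpace ℝ (Fin d) → EuclideanSpace ℝ (Fin d))
    (G : EuclideanSpace ℝ (Fin d) → ℝ) (γ : Measure (EuclideanSpace ℝ (Fin d))) :
    ℕ → (EuclideanSpace ℝ (Fin d) → ℝ) → EuclideanSpace ℝ (Fin d) → ℝ :=
  fun n => (FKstep Edom F G γ)^[n]

lemma quad_lower (M : Matrix (Fin d) (Fin d) ℝ) (hM : M.PosDef) :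
    ∃ l > (0:ℝ), ∀ v : EuclideanSpace ℝ (Fin d),
      l * ‖v‖ ^ 2 ≤ ∑ i, ∑ j, v i * M i j * v j := by
  have hq : ∀ v : EuclideanSpace ℝ (Fin d), v ≠ 0 → 0 < ∑ i, ∑ j, v i * M i j * v j := by
    intro v hv
    have := hM.dotProduct_mulVec_pos (x := fun i => v i)
      (by intro h; apply hv; ext i; exact congrFun h i)
    simpa [dotProduct, Matrix.mulVec, Finset.mul_sum, mul_assoc] using this
  have hc : Continuous fun v : EuclideanSpace ℝ (Fin d) => ∑ i, ∑ j, v i * M i j * v j := by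
    fun_prop
  by_cases hne : (Metric.sphere (0 : EuclideanSpace ℝ (Fin d)) 1).Nonempty
  · obtain ⟨u, hu, hmin⟩ := (isCompact_sphere (0 : EuclideanSpace ℝ (Fin d)) 1).exists_isMinOn
      hne hc.continuousOn
    have hu0 : u ≠ 0 := by
      intro h; simp [h] at hu
    refine ⟨_, hq u hu0, fun v => ?_⟩
    by_cases hv : v = 0
    · simp [hv]
    have hvn : 0 < ‖v‖ := norm_pos_iff.2 hv
    have h1 : ‖v‖⁻¹ • v ∈ Metric.sphere (0 : EuclideanSpace ℝ (Fin d)) 1 := by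
      simp [norm_smul, hvn.ne']
    have h2 := hmin h1
    simp only [Set.mem_ofPred_eq] at h2
    have h3 : ∑ i, ∑ j, (‖v‖⁻¹ • v) i * M i j * (‖v‖⁻¹ • v) j
        = (‖v‖⁻¹)^2 * ∑ i, ∑ j, v i * M i j * v j := by
      simp only [Finset.mul_sum]
      refine Finset.sum_congr rfl fun i _ => Finset.sum_congr rfl fun j _ => ?_
      simp; ring
    rw [h3] at h2
    calc _ ≤ _ := mul_le_mul_of_nonneg_right h2 (sq_nonneg ‖v‖)
      _ = _ := by field_simp
  · refine ⟨1, one_pos, fun v => ?_⟩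
    by_cases hv : v = 0
    · simp [hv]
    exact absurd ⟨‖v‖⁻¹ • v, by simp [norm_smul, (norm_pos_iff.2 hv).ne']⟩ hne

/-- Abstract noise data. -/
structure Noise (γ : Measure (EuclideanSpace ℝ (Fin d)))
    (g : EuclideanSpace ℝ (Fin d) → ℝ) : Prop where
  gm : Measurable g
  gpos : ∀ z, 0 < g z
  gmax : ∃ B > 0, ∀ z, g z ≤ B
  gloc : ∀ R : ℝ, ∃ δ > 0, ∀ z, ‖z‖ ≤ R → δ ≤ g z
  eq : γ = volume.withDensity (fun z => ENNReal.ofReal (g z))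
  mom : ∀ b : ℝ, Integrable (fun z => Real.exp (b * ‖z‖)) γ

lemma int_gauss (l : ℝ) (hl : 0 < l) :
    Integrable (fun z : EuclideanSpace ℝ (Fin d) => Real.exp (-l * ‖z‖ ^ 2)) := by
  have h := (GaussianFourier.integrable_cexp_neg_mul_sq_norm_add
    (V := EuclideanSpace ℝ (Fin d)) (b := (l : ℂ)) (by simpa using hl) 0 0).norm
  refine h.congr (ae_of_all _ fun z => ?_)
  simp only [Complex.norm_exp]
  congr 1
  simp [← Complex.ofReal_pow]

lemma noise_of_gaussian (γ : Measure (EuclideanSpace ℝ (Fin d))) (hγ : IsNondegGaussian γ) :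
    ∃ g, Noise γ g := by
  obtain ⟨m, Cov, hCov, hγ⟩ := hγ
  obtain ⟨l, hl, hq⟩ := quad_lower _ hCov.inv
  have hdet := hCov.det_pos
  set c : ℝ := (Real.sqrt ((2 * Real.pi) ^ d * Cov.det))⁻¹ with hc
  have hc0 : 0 < c := by positivity
  set g : EuclideanSpace ℝ (Fin d) → ℝ := fun z =>
    c * Real.exp (-(∑ i, ∑ j, (z i - m i) * Cov⁻¹ i j * (z j - m j)) / 2) with hg
  have hgc : Continuous g := by fun_prop
  have hgpos : ∀ z, 0 < g z := fun z => by positivity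
  have hgle : ∀ z, g z ≤ c * Real.exp (-(l * ‖z - m‖ ^ 2) / 2) := by
    intro z
    have := hq (z - m)
    simp only [PiLp.sub_apply] at this
    simp only [hg]
    gcongr
  refine ⟨g, hgc.measurable, hgpos, ⟨c, hc0, fun z => (hgle z).trans ?_⟩, ?_, hγ, ?_⟩
  · have : Real.exp (-(l * ‖z - m‖ ^ 2) / 2) ≤ 1 := by
      apply Real.exp_le_one_iff.2
      have : 0 ≤ l * ‖z - m‖ ^ 2 := by positivity
      linarith
    nlinarith
  · intro R
    by_cases hne : (Metric.closedBall (0 : EuclideanSpace ℝ (Fin d)) R).Nonempty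
    · obtain ⟨u, hu, hmin⟩ := (isCompact_closedBall (0 : EuclideanSpace ℝ (Fin d)) R).exists_isMinOn
        hne hgc.continuousOn
      exact ⟨g u, hgpos u, fun z hz => hmin (by simpa using hz)⟩
    · exact ⟨1, one_pos, fun z hz => absurd ⟨z, by simpa using hz⟩ hne⟩
  · intro b
    rw [hγ, integrable_withDensity_iff_integrable_smul' (by fun_prop) (by simp)]
    have h1 := ((int_gauss (d := d) (l/4) (by positivity)).comp_sub_right m).const_mul
      (c * Real.exp (|b| * ‖m‖ + |b|^2 / l))
    refine h1.mono' (by fun_prop) (ae_of_all _ fun z => ?_)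
    have hgz : ENNReal.toReal (ENNReal.ofReal (g z)) = g z := ENNReal.toReal_ofReal (hgpos z).le
    change ‖ENNReal.toReal (ENNReal.ofReal (g z)) • Real.exp (b * ‖z‖)‖ ≤ _
    rw [hgz, Real.norm_of_nonneg (by have := hgpos z; positivity), smul_eq_mul]
    calc g z * Real.exp (b * ‖z‖) ≤ (c * Real.exp (-(l * ‖z - m‖ ^ 2) / 2)) *
          Real.exp (|b| * (‖z - m‖ + ‖m‖)) := by
          gcongr
          · exact hgle z
          · exact le_abs_self b
          · simpa using norm_add_le (z - m) m
      _ = c * Real.exp (-(l * ‖z - m‖ ^ 2) / 2 + |b| * (‖z - m‖ + ‖m‖)) := by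
          rw [Real.exp_add]; ring
      _ ≤ c * Real.exp ((|b| * ‖m‖ + |b|^2 / l) + -(l/4) * ‖z - m‖ ^ 2) := by
          refine mul_le_mul_of_nonneg_left (Real.exp_le_exp.2 ?_) hc0.le
          have : 0 ≤ (l * ‖z-m‖ / 2 - |b|)^2 / l := by positivity
          have e : (l * ‖z-m‖ / 2 - |b|)^2 / l = l * ‖z-m‖^2/4 - |b| * ‖z-m‖ + |b|^2/l := by
            field_simp; ring
          rw [e] at this
          linarith
      _ = _ := by rw [Real.exp_add]; ring

/-- Bundled standing hypotheses. -/
structure Hyp (Edom : Set (EuclideanSpace ℝ (Fin d)))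
    (F : EuclideanSpace ℝ (Fin d) → EuclideanSpace ℝ (Fin d))
    (G : EuclideanSpace ℝ (Fin d) → ℝ) (γ : Measure (EuclideanSpace ℝ (Fin d)))
    (g : EuclideanSpace ℝ (Fin d) → ℝ) (C : ℝ) : Prop where
  hEm : MeasurableSet Edom
  hFm : Measurable F
  hFloc : ∀ R : ℝ, ∃ M : ℝ, ∀ x, ‖x‖ ≤ R → ‖F x‖ ≤ M
  hGm : Measurable G
  hGpos : ∀ x ∈ Edom, 0 < G x
  hGinv : ∀ R : ℝ, ∃ M : ℝ, ∀ x ∈ Edom, ‖x‖ ≤ R → 1 / G x ≤ M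
  hC : 0 < C
  hGg : ∀ x ∈ Edom, G x ≤ C * Real.exp ‖x‖
  no : Noise γ g

/-- Measurable nonnegative functions dominated by a multiple of `exp (b|x|)`. -/
structure Good (b : ℝ) (f : EuclideanSpace ℝ (Fin d) → ℝ) (B : ℝ) : Prop where
  m : Measurable f
  nn : ∀ x, 0 ≤ f x
  le : ∀ x, f x ≤ B * Real.exp (b * ‖x‖)

section
variable {Edom : Set (EuclideanSpace ℝ (Fin d))}
    {F : EuclideanSpace ℝ (Fin d) → EuclideanSpace ℝ (Fin d)}
    {G : EuclideanSpace ℝ (Fin d) → ℝ} {γ : Measure (EuclideanSpace ℝ (Fin d))}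
    {g : EuclideanSpace ℝ (Fin d) → ℝ} {C b B B' : ℝ}
    {f f' : EuclideanSpace ℝ (Fin d) → ℝ}

lemma Good.B_nonneg (hf : Good b f B) : 0 ≤ B := by
  have := (hf.nn 0).trans (hf.le 0)
  simpa using this

lemma Good.indicator (hf : Good b f B) {A : Set (EuclideanSpace ℝ (Fin d))}
    (hA : MeasurableSet A) : Good b (A.indicator f) B :=
  ⟨hf.m.indicator hA, fun x => Set.indicator_nonneg (fun x _ => hf.nn x) x,
    fun x => (Set.indicator_le_self' (fun x _ => hf.nn x) x).trans (hf.le x)⟩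

lemma Hyp.nn (H : Hyp Edom F G γ g C) (hf : ∀ x, 0 ≤ f x) (w) :
    0 ≤ Edom.indicator (fun y => G y * f y) w :=
  Set.indicator_nonneg (fun y hy => mul_nonneg (H.hGpos y hy).le (hf y)) w

lemma Hyp.bd (H : Hyp Edom F G γ g C) (hb : 0 ≤ b) (hf : Good b f B) (x z) :
    Edom.indicator (fun y => G y * f y) (F x + z) ≤
      (B * C * Real.exp ((1 + b) * ‖F x‖)) * Real.exp ((1 + b) * ‖z‖) := by
  have hB := hf.B_nonneg
  have hC := H.hC
  by_cases h : F x + z ∈ Edom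
  · rw [Set.indicator_of_mem h]
    calc G (F x + z) * f (F x + z)
        ≤ (C * Real.exp ‖F x + z‖) * (B * Real.exp (b * ‖F x + z‖)) :=
          mul_le_mul (H.hGg _ h) (hf.le _) (hf.nn _) (by positivity)
      _ = B * C * Real.exp ((1 + b) * ‖F x + z‖) := by
          rw [add_mul, one_mul, Real.exp_add]; ring
      _ ≤ B * C * Real.exp ((1 + b) * (‖F x‖ + ‖z‖)) := by
          gcongr
          exact norm_add_le _ _
      _ = _ := by rw [mul_add, Real.exp_add]; ring
  · rw [Set.indicator_of_notMem h]; positivity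

lemma Hyp.meas (H : Hyp Edom F G γ g C) (hf : Measurable f) :
    Measurable (Edom.indicator (fun y => G y * f y)) :=
  (H.hGm.mul hf).indicator H.hEm

lemma Hyp.integrable (H : Hyp Edom F G γ g C) (hb : 0 ≤ b) (hf : Good b f B) (x) :
    Integrable (fun z => Edom.indicator (fun y => G y * f y) (F x + z)) γ := by
  refine ((H.no.mom (1 + b)).const_mul (B * C * Real.exp ((1 + b) * ‖F x‖))).mono' ?_ ?_
  · exact ((H.meas hf.m).comp (measurable_const_add (F x))).aestronglyMeasurable
  · refine ae_of_all _ fun z => ?_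
    rw [Real.norm_of_nonneg (H.nn hf.nn _)]
    exact H.bd hb hf x z

lemma Hyp.P_le (H : Hyp Edom F G γ g C) (hb : 0 ≤ b) (hf : Good b f B) (x) :
    FKstep Edom F G γ f x ≤
      (B * C * Real.exp ((1 + b) * ‖F x‖)) * ∫ z, Real.exp ((1 + b) * ‖z‖) ∂γ := by
  rw [← integral_const_mul]
  exact integral_mono (H.integrable hb hf x) ((H.no.mom (1 + b)).const_mul _)
    (fun z => H.bd hb hf x z)

lemma Hyp.P_mono (H : Hyp Edom F G γ g C) (hb : 0 ≤ b) (hf : Good b f B) (hf' : Good b f' B')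
    (hle : ∀ x ∈ Edom, f x ≤ f' x) (x) :
    FKstep Edom F G γ f x ≤ FKstep Edom F G γ f' x := by
  refine integral_mono (H.integrable hb hf x) (H.integrable hb hf' x) (fun z => ?_)
  exact Set.indicator_le_indicator' fun h => mul_le_mul_of_nonneg_left (hle _ h) (H.hGpos _ h).le

lemma Hyp.P_nonneg (H : Hyp Edom F G γ g C) (hf : ∀ x, 0 ≤ f x) (x) :
    0 ≤ FKstep Edom F G γ f x := integral_nonneg fun _ => H.nn hf _

lemma P_smul (c : ℝ) (x) :
    FKstep Edom F G γ (fun y => c * f y) x = c * FKstep Edom F G γ f x := by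
  unfold FKstep
  rw [← integral_const_mul]
  congr 1; ext z
  by_cases h : F x + z ∈ Edom
  · simp only [Set.indicator_of_mem h]; ring
  · simp only [Set.indicator_of_notMem h]; ring

lemma Hyp.P_add (H : Hyp Edom F G γ g C) (hb : 0 ≤ b) (hf : Good b f B) (hf' : Good b f' B') (x) :
    FKstep Edom F G γ (fun y => f y + f' y) x =
      FKstep Edom F G γ f x + FKstep Edom F G γ f' x := by
  unfold FKstep
  rw [← integral_add (H.integrable hb hf x) (H.integrable hb hf' x)]
  congr 1; ext z
  by_cases h : F x + z ∈ Edom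
  · simp only [Set.indicator_of_mem h]; ring
  · simp only [Set.indicator_of_notMem h]; ring

lemma Hyp.fin (H : Hyp Edom F G γ g C) : IsFiniteMeasure γ := by
  have := H.no.mom 0
  simp only [zero_mul, Real.exp_zero] at this
  rcases (integrable_const_iff (c := (1:ℝ))).1 this with h | h
  · norm_num at h
  · exact h

lemma Hyp.P_meas (H : Hyp Edom F G γ g C) (hf : Measurable f) :
    Measurable (FKstep Edom F G γ f) := by
  have := H.fin
  have h : Measurable (fun q : EuclideanSpace ℝ (Fin d) × EuclideanSpace ℝ (Fin d) =>
      Edom.indicator (fun y => G y * f y) (F q.1 + q.2)) :=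
    (H.meas hf).comp ((H.hFm.comp measurable_fst).add measurable_snd)
  exact (h.stronglyMeasurable.integral_prod_right (ν := γ)).measurable

/-- Density form. -/
lemma Hyp.P_eq (H : Hyp Edom F G γ g C) (x) :
    FKstep Edom F G γ f x =
      ∫ w, g (w - F x) * Edom.indicator (fun y => G y * f y) w := by
  unfold FKstep
  have hgm := H.no.gm
  rw [H.no.eq, integral_withDensity_eq_integral_toReal_smul (by fun_prop) (by simp)]
  rw [← integral_add_left_eq_self (fun w => g (w - F x) * Edom.indicator (fun y => G y * f y) w) (F x)]
  congr 1; ext z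
  rw [ENNReal.toReal_ofReal (H.no.gpos z).le, add_sub_cancel_left, smul_eq_mul]

lemma Hyp.integrable_vol (H : Hyp Edom F G γ g C) (hb : 0 ≤ b) (hf : Good b f B) (x) :
    Integrable (fun w => g (w - F x) * Edom.indicator (fun y => G y * f y) w) := by
  have h := H.integrable hb hf x
  have hgm := H.no.gm
  rw [H.no.eq, integrable_withDensity_iff_integrable_smul' (by fun_prop) (by simp)] at h
  refine (h.comp_sub_right (F x)).congr (ae_of_all _ fun z => ?_)
  dsimp only
  rw [ENNReal.toReal_ofReal (H.no.gpos _).le, add_sub_cancel, smul_eq_mul]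

lemma Hyp.gbd (H : Hyp Edom F G γ g C) (R : ℝ) :
    ∃ δ > 0, ∀ x w, ‖x‖ ≤ R → ‖w‖ ≤ R → δ ≤ g (w - F x) := by
  obtain ⟨M, hM⟩ := H.hFloc R
  obtain ⟨δ, hδ, h⟩ := H.no.gloc (R + M)
  refine ⟨δ, hδ, fun x w hx hw => h _ ((norm_sub_le _ _).trans ?_)⟩
  have := hM x hx
  linarith

/-- Local minorization. -/
lemma Hyp.lower (H : Hyp Edom F G γ g C) (R : ℝ) :
    ∃ c > 0, ∀ x, ‖x‖ ≤ R → ∀ A : Set (EuclideanSpace ℝ (Fin d)), MeasurableSet A →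
      A ⊆ Edom ∩ Metric.closedBall 0 R →
      c * (volume A).toReal ≤ FKstep Edom F G γ (A.indicator fun _ => (1:ℝ)) x := by
  obtain ⟨δ, hδ, h⟩ := H.gbd R
  obtain ⟨M, hM⟩ := H.hGinv R
  have hM1 : 0 < |M| + 1 := by positivity
  refine ⟨δ * (|M| + 1)⁻¹, by positivity, fun x hx A hA hAs => ?_⟩
  rw [H.P_eq]
  have hAfin : volume A < ⊤ :=
    (measure_mono (hAs.trans Set.inter_subset_right)).trans_lt measure_closedBall_lt_top
  have hgood : Good (d := d) 0 (A.indicator fun _ => (1:ℝ)) 1 :=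
    Good.indicator ⟨measurable_const, fun _ => zero_le_one, fun _ => by simp⟩ hA
  have e : δ * (|M| + 1)⁻¹ * (volume A).toReal
      = ∫ w, A.indicator (fun _ => δ * (|M| + 1)⁻¹) w := by
    rw [integral_indicator_const _ hA, smul_eq_mul, mul_comm]; rfl
  rw [e]
  refine integral_mono ?_ (H.integrable_vol le_rfl hgood x) fun w => ?_
  · exact (integrable_indicator_iff hA).2 (integrableOn_const hAfin.ne)
  · by_cases hw : w ∈ A
    · have hE := (hAs hw).1
      have hwR : ‖w‖ ≤ R := by simpa using (hAs hw).2
      have hG := H.hGpos w hE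
      have h2 : (|M| + 1)⁻¹ ≤ G w := by
        rw [inv_le_comm₀ hM1 hG, ← one_div]
        exact (hM w hE hwR).trans ((le_abs_self M).trans (by linarith))
      simp only [Set.indicator_of_mem hw, Set.indicator_of_mem hE, mul_one]
      exact mul_le_mul (h x w hx hwR) h2 (by positivity) (H.no.gpos _).le
    · rw [Set.indicator_of_notMem hw]
      exact mul_nonneg (H.no.gpos _).le (H.nn hgood.nn w)

/-- Local Harnack comparison for functions supported in a ball. -/
lemma Hyp.harnack (H : Hyp Edom F G γ g C) (R : ℝ) :
    ∃ c > 0, ∀ b B f, 0 ≤ b → Good b f B → (∀ w, R < ‖w‖ → f w = 0) →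
      ∀ x z, ‖z‖ ≤ R →
      FKstep Edom F G γ f x ≤ c * FKstep Edom F G γ f z := by
  obtain ⟨δ, hδ, h⟩ := H.gbd R
  obtain ⟨M, hM0, hM⟩ := H.no.gmax
  refine ⟨M / δ, by positivity, fun b B f hb hf hs x z hz => ?_⟩
  rw [H.P_eq, H.P_eq, ← integral_const_mul]
  refine integral_mono (H.integrable_vol hb hf x) ((H.integrable_vol hb hf z).const_mul _)
    fun w => ?_
  dsimp only
  by_cases hw : ‖w‖ ≤ R
  · rw [← mul_assoc]
    refine mul_le_mul_of_nonneg_right ?_ (H.nn hf.nn w)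
    calc g (w - F x) ≤ M := hM _
      _ = M / δ * δ := by field_simp
      _ ≤ _ := by gcongr; exact h z w hz hw
  · have : Edom.indicator (fun y => G y * f y) w = 0 := by
      simp [Set.indicator, hs w (not_le.1 hw)]
    simp [this]

end

set_option maxHeartbeats 2000000

/-- Proposition: under assumptions (H), the Feynman–Kac semigroup of the perturbed
dynamical system satisfies Condition (G) on `Edom` with `ψ₁(x) = exp(a|x|)`, for any
`a > 0` with `1/a < p - 1`. -/
theorem FK_satisfies_condG
    (Edom : Set (EuclideanSpace ℝ (Fin d)))
    (hEm : MeasurableSet Edom) (hEpos : 0 < volume Edom)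
    (F : EuclideanSpace ℝ (Fin d) → EuclideanSpace ℝ (Fin d))
    (hFm : Measurable F)
    (hFloc : ∀ R : ℝ, ∃ M : ℝ, ∀ x, ‖x‖ ≤ R → ‖F x‖ ≤ M)
    (G : EuclideanSpace ℝ (Fin d) → ℝ)
    (hGm : Measurable G) (hGpos : ∀ x ∈ Edom, 0 < G x)
    (hGinvloc : ∀ R : ℝ, ∃ M : ℝ, ∀ x ∈ Edom, ‖x‖ ≤ R → 1 / G x ≤ M)
    (C : ℝ) (hC : 0 < C) (hGgrowth : ∀ x ∈ Edom, G x ≤ C * Real.exp ‖x‖)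
    (p : ℝ) (hp : 1 < p)
    (hdrift : ∀ M : ℝ, ∃ R : ℝ, ∀ x, R ≤ ‖x‖ → M ≤ ‖x‖ - p * ‖F x‖)
    (γ : Measure (EuclideanSpace ℝ (Fin d))) (hγ : IsNondegGaussian γ)
    (a : ℝ) (ha : 0 < a) (hap : 1 / a < p - 1) :
    ∃ (θ₁ θ₂ c₁ c₂ c₃ : ℝ) (n₁ : ℕ) (ψ₂ : EuclideanSpace ℝ (Fin d) → ℝ)
      (K : Set (EuclideanSpace ℝ (Fin d))) (ν : Measure (EuclideanSpace ℝ (Fin d))),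
      0 < θ₁ ∧ θ₁ < θ₂ ∧ 0 < c₁ ∧ 0 < c₂ ∧ 0 < c₃ ∧ 1 ≤ n₁ ∧
      Measurable ψ₂ ∧ (∀ x, 0 ≤ ψ₂ x) ∧ (∀ x, ψ₂ x ≤ Real.exp (a * ‖x‖)) ∧
      K ⊆ Edom ∧ MeasurableSet K ∧ IsProbabilityMeasure ν ∧ ν Kᶜ = 0 ∧
      -- (G1) local Dobrushin coefficient
      (∀ x ∈ K, ∀ A ⊆ K, MeasurableSet A →
        c₁ * (ν A).toReal * Real.exp (a * ‖x‖) ≤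
          FK Edom F G γ n₁ (A.indicator fun y => Real.exp (a * ‖y‖)) x) ∧
      -- (G2) global Lyapunov criterion
      (∃ ε > (0:ℝ), ∀ x ∈ K, ε * Real.exp (a * ‖x‖) ≤ ψ₂ x) ∧
      (∀ x ∈ Edom, FK Edom F G γ 1 (fun y => Real.exp (a * ‖y‖)) x ≤
        θ₁ * Real.exp (a * ‖x‖) + K.indicator (fun y => c₂ * Real.exp (a * ‖y‖)) x) ∧
      (∀ x ∈ Edom, θ₂ * ψ₂ x ≤ FK Edom F G γ 1 ψ₂ x) ∧
      -- (G3) local Harnack inequality (cross-multiplied form of sup/inf ≤ c₃)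
      (∀ n : ℕ, ∀ y ∈ K, ∀ z ∈ K,
        FK Edom F G γ n (fun w => Real.exp (a * ‖w‖)) y * Real.exp (a * ‖z‖) ≤
          c₃ * FK Edom F G γ n (fun w => Real.exp (a * ‖w‖)) z * Real.exp (a * ‖y‖)) ∧
      -- (G4) aperiodicity
      (∀ x ∈ K, ∃ n₄ : ℕ, ∀ n ≥ n₄,
        0 < FK Edom F G γ n (K.indicator fun y => Real.exp (a * ‖y‖)) x) := by
  obtain ⟨g, no⟩ := noise_of_gaussian γ hγ
  have H : Hyp Edom F G γ g C :=
    ⟨hEm, hFm, hFloc, hGm, hGpos, hGinvloc, hC, hGgrowth, no⟩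
  set ψ : EuclideanSpace ℝ (Fin d) → ℝ := fun y => Real.exp (a * ‖y‖) with hψdef
  set P := FKstep Edom F G γ with hP
  have FK0 : ∀ f, FK Edom F G γ 0 f = f := fun f => rfl
  have FK1 : ∀ f, FK Edom F G γ 1 f = P f := fun f => rfl
  have FKs : ∀ n f, FK Edom F G γ (n+1) f = P (FK Edom F G γ n f) := fun n f =>
    Function.iterate_succ_apply' _ _ _
  have hψ1 : ∀ x, 1 ≤ ψ x := fun x => Real.one_le_exp (by positivity)
  have hψm : Measurable ψ := by fun_prop
  have hψ : Good a ψ 1 := ⟨hψm, fun x => (Real.exp_pos _).le, fun x => by simp [hψdef]⟩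
  have hone : ∀ A : Set (EuclideanSpace ℝ (Fin d)), MeasurableSet A →
      Good a (A.indicator fun _ => (1:ℝ)) 1 := fun A hA =>
    Good.indicator ⟨measurable_const, fun _ => zero_le_one, fun x => by rw [one_mul]; exact hψ1 x⟩ hA
  -- the small set
  obtain ⟨R0, hR0⟩ : ∃ R0 : ℝ, 0 < volume (Edom ∩ Metric.closedBall 0 R0) := by
    by_contra hcon
    push Not at hcon
    have h0 : volume (⋃ n : ℕ, Edom ∩ Metric.closedBall 0 (n:ℝ)) = 0 :=
      measure_iUnion_null fun n => le_antisymm (hcon n) zero_le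
    rw [← Set.inter_iUnion, Metric.iUnion_closedBall_nat, Set.inter_univ] at h0
    exact hEpos.ne' h0
  set K0 := Edom ∩ Metric.closedBall 0 R0 with hK0
  have hK0m : MeasurableSet K0 := hEm.inter measurableSet_closedBall
  have hfin : ∀ R : ℝ, volume (Edom ∩ Metric.closedBall 0 R) < ⊤ := fun R =>
    (measure_mono Set.inter_subset_right).trans_lt measure_closedBall_lt_top
  set v0 := (volume K0).toReal with hv0
  have hv0p : 0 < v0 := ENNReal.toReal_pos hR0.ne' (hfin R0).ne
  set κ := P (K0.indicator fun _ => (1:ℝ)) with hκ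
  obtain ⟨c0, hc0, hlow0⟩ := H.lower R0
  set θ₂ := c0 * v0 with hθ₂
  have hθ₂p : 0 < θ₂ := by positivity
  have hκ0 : ∀ x ∈ K0, θ₂ ≤ κ x := fun x hx =>
    hlow0 x (by simpa using hx.2) K0 hK0m le_rfl
  set θ₁ := θ₂ / 2 with hθ₁
  have hθ₁p : 0 < θ₁ := by positivity
  -- drift
  obtain ⟨R, hRR0, hR⟩ : ∃ R, R0 ≤ R ∧ ∀ x, R < ‖x‖ → P ψ x ≤ θ₁ * ψ x := by
    set Mo := ∫ z, Real.exp ((1 + a) * ‖z‖) ∂γ with hMo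
    have hMo0 : 0 ≤ Mo := integral_nonneg fun _ => (Real.exp_pos _).le
    set t := θ₁ / (C * (Mo + 1)) with ht
    have htp : 0 < t := by positivity
    obtain ⟨R, hR⟩ := hdrift (-(Real.log t) / a)
    refine ⟨max R0 R, le_max_left _ _, fun x hx => ?_⟩
    have h1 := hR x ((le_max_right _ _).trans hx.le)
    have h2 : 1 + a ≤ a * p := by
      rw [div_lt_iff₀ ha] at hap
      linarith
    have h3 : (1 + a) * ‖F x‖ ≤ a * ‖x‖ + Real.log t := by
      have := mul_le_mul_of_nonneg_right h2 (norm_nonneg (F x))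
      have h4 := mul_le_mul_of_nonneg_left h1 ha.le
      have h5 : a * (-(Real.log t) / a) = - Real.log t := by field_simp
      rw [h5] at h4
      linarith
    have h4 := H.P_le ha.le hψ x
    calc P ψ x ≤ _ := h4
      _ ≤ (1 * C * Real.exp (a * ‖x‖ + Real.log t)) * (Mo + 1) := by
          gcongr
          linarith
      _ = θ₁ * ψ x := by
          rw [Real.exp_add, Real.exp_log htp, ht]
          field_simp
          try rfl
  obtain ⟨MF, hMF⟩ := hFloc R
  obtain ⟨D, hDp, hD⟩ : ∃ D > 0, ∀ x, ‖x‖ ≤ R → P ψ x ≤ D := by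
    have hMo0 : 0 ≤ ∫ z, Real.exp ((1 + a) * ‖z‖) ∂γ := integral_nonneg fun _ => (Real.exp_pos _).le
    refine ⟨(1 * C * Real.exp ((1 + a) * MF)) * (∫ z, Real.exp ((1 + a) * ‖z‖) ∂γ) + 1,
      by positivity, fun x hx => (H.P_le ha.le hψ x).trans ?_⟩
    have : (1 * C * Real.exp ((1 + a) * ‖F x‖)) * (∫ z, Real.exp ((1 + a) * ‖z‖) ∂γ)
      ≤ (1 * C * Real.exp ((1 + a) * MF)) * (∫ z, Real.exp ((1 + a) * ‖z‖) ∂γ) := by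
      gcongr
      exact hMF x hx
    linarith
  have hPψ : ∀ x, P ψ x ≤ (θ₁ + D) * ψ x := by
    intro x
    have := hψ1 x
    rcases le_or_gt ‖x‖ R with h | h
    · have := hD x h
      nlinarith
    · have := hR x h
      nlinarith
  have goodP : ∀ f B, Good a f B → Good a (P f) (B * (θ₁ + D)) := by
    intro f B hf
    refine ⟨H.P_meas hf.m, H.P_nonneg hf.nn, fun x => ?_⟩
    have hB := hf.B_nonneg
    have h1 : P f x ≤ P (fun y => B * ψ y) x :=
      H.P_mono ha.le hf (f' := fun y => B * ψ y) (B' := B)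
        ⟨hψm.const_mul B, fun x => mul_nonneg hB (hψ.nn x), fun x => le_rfl⟩ (fun x _ => hf.le x) x
    rw [hP, P_smul, ← hP] at h1
    calc P f x ≤ B * P ψ x := h1
      _ ≤ B * ((θ₁ + D) * ψ x) := by gcongr; exact hPψ x
      _ = _ := by rw [mul_assoc]
  have goodFK : ∀ n f B, Good a f B → ∃ B', Good a (FK Edom F G γ n f) B' := by
    intro n f B hf
    induction n with
    | zero => exact ⟨B, hf⟩
    | succ n ih =>
      obtain ⟨B', h⟩ := ih
      rw [FKs]
      exact ⟨_, goodP _ _ h⟩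
  set K := Edom ∩ Metric.closedBall 0 R with hK
  have hKm : MeasurableSet K := hEm.inter measurableSet_closedBall
  have hK0K : K0 ⊆ K := Set.inter_subset_inter_right _ (Metric.closedBall_subset_closedBall hRR0)
  have hKn : ∀ x ∈ K, ‖x‖ ≤ R := fun x hx => by simpa using hx.2
  have hψR : ∀ x ∈ K, ψ x ≤ Real.exp (a * R) := fun x hx => by
    have := hKn x hx
    simp only [hψdef]
    gcongr
  have hKpos : 0 < volume K := hR0.trans_le (measure_mono hK0K)
  set vK := (volume K).toReal with hvK
  have hvKp : 0 < vK := ENNReal.toReal_pos hKpos.ne' (hfin R).ne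
  obtain ⟨c1, hc1, hlow⟩ := H.lower R
  set κR := c1 * v0 with hκR
  have hκRp : 0 < κR := by positivity
  have hκK : ∀ x, ‖x‖ ≤ R → κR ≤ κ x := fun x hx => hlow x hx K0 hK0m hK0K
  have hκg := goodP _ _ (hone K0 hK0m)
  -- tail
  obtain ⟨R', hRR', hR'⟩ : ∃ R', R ≤ R' ∧ ∀ x, ‖x‖ ≤ R →
      P ((Metric.closedBall 0 R')ᶜ.indicator ψ) x ≤ θ₂ / 2 := by
    have hMo0 : 0 ≤ ∫ z, Real.exp ((1 + (a + 1)) * ‖z‖) ∂γ :=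
      integral_nonneg fun _ => (Real.exp_pos _).le
    set Q := (C * Real.exp ((1 + (a + 1)) * MF)) * (∫ z, Real.exp ((1 + (a + 1)) * ‖z‖) ∂γ) + 1
      with hQ
    have hQp : 0 < Q := by positivity
    refine ⟨max R (-Real.log (θ₂ / 2 / Q)), le_max_left _ _, fun x hx => ?_⟩
    set R' := max R (-Real.log (θ₂ / 2 / Q))
    have hg : Good (a + 1) ((Metric.closedBall 0 R')ᶜ.indicator ψ) (Real.exp (-R')) := by
      refine ⟨hψm.indicator measurableSet_closedBall.compl,
        (hψ.indicator measurableSet_closedBall.compl).nn, fun w => ?_⟩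
      by_cases hw : w ∈ (Metric.closedBall (0 : EuclideanSpace ℝ (Fin d)) R')ᶜ
      · rw [Set.indicator_of_mem hw, ← Real.exp_add]
        apply Real.exp_le_exp.2
        have : R' < ‖w‖ := by simpa using hw
        linarith
      · rw [Set.indicator_of_notMem hw]; positivity
    refine (H.P_le (by positivity) hg x).trans ?_
    have e1 : Real.exp (-R') ≤ θ₂ / 2 / Q := by
      rw [← Real.le_log_iff_exp_le (by positivity)]
      have := le_max_right R (-Real.log (θ₂ / 2 / Q))
      change -R' ≤ _
      linarith
    calc (Real.exp (-R') * C * Real.exp ((1 + (a + 1)) * ‖F x‖)) *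
          (∫ z, Real.exp ((1 + (a + 1)) * ‖z‖) ∂γ)
        ≤ (Real.exp (-R') * C * Real.exp ((1 + (a + 1)) * MF)) *
          (∫ z, Real.exp ((1 + (a + 1)) * ‖z‖) ∂γ) := by
          gcongr
          exact hMF x hx
      _ = Real.exp (-R') * (Q - 1) := by rw [hQ]; ring
      _ ≤ (θ₂ / 2 / Q) * Q := by
          have : 0 < Real.exp (-R') := Real.exp_pos _
          nlinarith
      _ = θ₂ / 2 := by field_simp
  obtain ⟨cH, hcH, harn⟩ := H.harnack R'
  set A := 1 + 2 * cH with hA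
  have hAp : 0 < A := by positivity
  set h : ℕ → EuclideanSpace ℝ (Fin d) → ℝ := fun n => FK Edom F G γ n ψ with hh
  have hgood : ∀ n, ∃ B, Good a (h n) B := fun n => goodFK n ψ 1 hψ
  have hs : ∀ n, h (n+1) = P (h n) := fun n => FKs n ψ
  -- propagation
  have key : ∀ n, (∀ x, ∀ z ∈ K0, h n x ≤ A * ψ x * h n z) → ∀ x z, ‖z‖ ≤ R →
      h n x ≤ (A * h (n+1) z / κ z) * ψ x := by
    intro n hn x z hz
    obtain ⟨B, hB⟩ := hgood n
    have hκz : 0 < κ z := hκRp.trans_le (hκK z hz)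
    have hx0 := hB.nn x
    have hAψ : 0 ≤ A * ψ x := mul_nonneg hAp.le (hψ.nn x)
    have h1 : P (fun y => h n x * K0.indicator (fun _ => (1:ℝ)) y) z ≤
        P (fun y => (A * ψ x) * h n y) z := by
      refine H.P_mono ha.le (B := h n x * 1) (B' := A * ψ x * B) ⟨?_, ?_, ?_⟩ ⟨?_, ?_, ?_⟩ ?_ z
      · exact (hone K0 hK0m).m.const_mul _
      · exact fun y => mul_nonneg hx0 ((hone K0 hK0m).nn y)
      · intro y
        rw [mul_assoc]
        exact mul_le_mul_of_nonneg_left ((hone K0 hK0m).le y) hx0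
      · exact hB.m.const_mul _
      · exact fun y => mul_nonneg hAψ (hB.nn y)
      · intro y
        rw [mul_assoc _ B]
        exact mul_le_mul_of_nonneg_left (hB.le y) hAψ
      · intro y _
        by_cases hy : y ∈ K0
        · rw [Set.indicator_of_mem hy, mul_one]; exact hn x y hy
        · rw [Set.indicator_of_notMem hy, mul_zero]; exact mul_nonneg hAψ (hB.nn y)
    rw [hP, P_smul, P_smul, ← hP, ← hs] at h1
    change h n x * κ z ≤ _ at h1
    rw [div_mul_eq_mul_div, le_div_iff₀ hκz]
    linarith
  have decomp : ∀ n, (∀ x, ∀ z ∈ K0, h n x ≤ A * ψ x * h n z) → ∀ x z, ‖x‖ ≤ R → ‖z‖ ≤ R →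
      h (n+1) x ≤ cH * h (n+1) z + (A * h (n+1) z / κ z) * (θ₂ / 2) := by
    intro n hn x z hx hz
    obtain ⟨B, hB⟩ := hgood n
    have hκz : 0 < κ z := hκRp.trans_le (hκK z hz)
    have hsz : 0 ≤ h (n+1) z := by rw [hs]; exact H.P_nonneg hB.nn z
    set T := A * h (n+1) z / κ z with hT
    have hT0 : 0 ≤ T := by positivity
    set S := Metric.closedBall (0 : EuclideanSpace ℝ (Fin d)) R' with hS
    have hSm : MeasurableSet S := measurableSet_closedBall
    have e : h n = fun y => S.indicator (h n) y + Sᶜ.indicator (h n) y := by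
      ext y; exact (congrFun (Set.indicator_self_add_compl S (h n)) y).symm
    have e2 : h (n+1) x = P (S.indicator (h n)) x + P (Sᶜ.indicator (h n)) x := by
      rw [hs]
      conv_lhs => rw [e]
      exact H.P_add ha.le (hB.indicator hSm) (hB.indicator hSm.compl) x
    rw [e2]
    refine add_le_add ?_ ?_
    · refine (harn a B _ ha.le (hB.indicator hSm) ?_ x z (hz.trans hRR')).trans ?_
      · intro w hw
        apply Set.indicator_of_notMem
        simpa [hS] using hw
      · refine mul_le_mul_of_nonneg_left ?_ hcH.le
        rw [hs]
        exact H.P_mono ha.le (hB.indicator hSm) hB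
          (fun y _ => Set.indicator_le_self' (fun y _ => hB.nn y) y) z
    · have h1 : P (Sᶜ.indicator (h n)) x ≤ P (fun y => T * Sᶜ.indicator ψ y) x := by
        refine H.P_mono ha.le (B' := T * 1) (hB.indicator hSm.compl) ⟨?_, ?_, ?_⟩ ?_ x
        · exact (hψ.indicator hSm.compl).m.const_mul _
        · exact fun y => mul_nonneg hT0 ((hψ.indicator hSm.compl).nn y)
        · intro y
          rw [mul_assoc]
          exact mul_le_mul_of_nonneg_left ((hψ.indicator hSm.compl).le y) hT0
        · intro y _
          by_cases hy : y ∈ Sᶜ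
          · rw [Set.indicator_of_mem hy, Set.indicator_of_mem hy]; exact key n hn y z hz
          · rw [Set.indicator_of_notMem hy, Set.indicator_of_notMem hy, mul_zero]
      rw [hP, P_smul, ← hP] at h1
      exact h1.trans (mul_le_mul_of_nonneg_left (hR' x hx) hT0)
  have claim : ∀ n, ∀ x, ∀ z ∈ K0, h n x ≤ A * ψ x * h n z := by
    intro n
    induction n with
    | zero =>
      intro x z _
      change ψ x ≤ A * ψ x * ψ z
      have h1 := hψ1 x
      have h2 := hψ1 z
      have h3 : 1 ≤ A := by linarith
      have h4 : ψ x ≤ A * ψ x := by nlinarith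
      nlinarith
    | succ n ih =>
      intro x z hz
      have hzR := hKn z (hK0K hz)
      obtain ⟨B, hB⟩ := hgood n
      have hsz : 0 ≤ h (n+1) z := by rw [hs]; exact H.P_nonneg hB.nn z
      have hκz := hκ0 z hz
      have hκzp : 0 < κ z := hθ₂p.trans_le hκz
      have hT : A * h (n+1) z / κ z * (θ₂ / 2) ≤ A * h (n+1) z / 2 := by
        rw [div_mul_eq_mul_div, div_le_iff₀ hκzp]
        have : 0 ≤ A * h (n+1) z := by positivity
        nlinarith
      have hx1 := hψ1 x
      rcases le_or_gt ‖x‖ R with hx | hx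
      · have h1 := decomp n ih x z hx hzR
        have h2 : h (n+1) x ≤ A * h (n+1) z := by
          have : A * h (n+1) z = h (n+1) z + 2 * (cH * h (n+1) z) := by rw [hA]; ring
          nlinarith
        have : 0 ≤ A * h (n+1) z := by positivity
        nlinarith
      · set T := A * h (n+1) z / κ z with hTd
        have hT0 : 0 ≤ T := by positivity
        have h1 : P (h n) x ≤ P (fun y => T * ψ y) x := by
          refine H.P_mono ha.le (B' := T) hB ⟨?_, ?_, ?_⟩ ?_ x
          · exact hψm.const_mul _
          · exact fun y => mul_nonneg hT0 (hψ.nn y)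
          · exact fun y => le_rfl
          · exact fun y _ => key n ih y z hzR
        rw [hP, P_smul, ← hP, ← hs] at h1
        have h2 : T * P ψ x ≤ T * (θ₁ * ψ x) := mul_le_mul_of_nonneg_left (hR x hx) hT0
        have h3 : T * (θ₁ * ψ x) ≤ A * h (n+1) z / 2 * ψ x := by
          rw [← mul_assoc]
          exact mul_le_mul_of_nonneg_right hT (hψ.nn x)
        have : 0 ≤ A * h (n+1) z * ψ x := mul_nonneg (by positivity) (hψ.nn x)
        nlinarith
  have harnK : ∀ n, ∀ y ∈ K, ∀ z ∈ K,
      h (n+1) y ≤ (cH + A * θ₂ / (2 * κR)) * h (n+1) z := by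
    intro n y hy z hz
    have h1 := decomp n (claim n) y z (hKn y hy) (hKn z hz)
    obtain ⟨B, hB⟩ := hgood n
    have hsz : 0 ≤ h (n+1) z := by rw [hs]; exact H.P_nonneg hB.nn z
    have h2 : A * h (n+1) z / κ z * (θ₂ / 2) ≤ A * h (n+1) z / κR * (θ₂ / 2) := by
      gcongr
      exact hκK z (hKn z hz)
    have h3 : A * h (n+1) z / κR * (θ₂ / 2) = A * θ₂ / (2 * κR) * h (n+1) z := by
      field_simp
    rw [add_mul]
    linarith
  set δ := (θ₁ + D)⁻¹ with hδ
  have hδp : 0 < δ := by positivity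
  have hEaR : 0 < Real.exp (a * R) := Real.exp_pos _
  -- P of indicators of subsets of K
  have lowψ : ∀ x ∈ K, ∀ A ⊆ K, MeasurableSet A →
      c1 * (volume A).toReal ≤ P (A.indicator ψ) x := by
    intro x hx A hAK hAm
    refine (hlow x (hKn x hx) A hAm hAK).trans ?_
    exact H.P_mono ha.le (hone A hAm) (hψ.indicator hAm)
      (fun y _ => Set.indicator_le_indicator (hψ1 y)) x
  refine ⟨θ₁, θ₂, c1 * vK * (Real.exp (a * R))⁻¹, D,
    1 + (cH + A * θ₂ / (2 * κR)) * Real.exp (a * R), 1, fun x => δ * κ x, K,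
    ProbabilityTheory.cond volume K, hθ₁p, by linarith, by positivity, hDp, by positivity, le_rfl,
    hκg.m.const_mul _, fun x => mul_nonneg hδp.le (hκg.nn x), ?_, Set.inter_subset_left, hKm,
    ProbabilityTheory.cond_isProbabilityMeasure_of_finite hKpos.ne' (hfin R).ne, ?_, ?_, ?_, ?_, ?_,
    ?_, ?_⟩
  · intro x
    have := hκg.le x
    rw [one_mul] at this
    calc δ * κ x ≤ δ * ((θ₁ + D) * Real.exp (a * ‖x‖)) := by gcongr
      _ = _ := by rw [hδ]; field_simp
  · rw [ProbabilityTheory.cond_apply hKm]; simp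
  · intro x hx A hAK hAm
    rw [FK1]
    refine le_trans ?_ (lowψ x hx A hAK hAm)
    rw [ProbabilityTheory.cond_apply hKm, Set.inter_eq_right.2 hAK, ENNReal.toReal_mul,
      ENNReal.toReal_inv]
    change c1 * vK * (Real.exp (a * R))⁻¹ * (vK⁻¹ * (volume A).toReal) * ψ x ≤ _
    have e : c1 * vK * (Real.exp (a * R))⁻¹ * (vK⁻¹ * (volume A).toReal) * ψ x
        = c1 * (volume A).toReal * ((Real.exp (a * R))⁻¹ * ψ x) := by
      field_simp
    rw [e]
    refine mul_le_of_le_one_right (by positivity) ?_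
    rw [inv_mul_le_iff₀ hEaR, mul_one]
    exact hψR x hx
  · refine ⟨δ * κR * (Real.exp (a * R))⁻¹, by positivity, fun x hx => ?_⟩
    have h1 := hψR x hx
    have h2 := hκK x (hKn x hx)
    calc δ * κR * (Real.exp (a * R))⁻¹ * Real.exp (a * ‖x‖)
        = δ * κR * ((Real.exp (a * R))⁻¹ * ψ x) := by rw [mul_assoc]
      _ ≤ δ * κR := by
        refine mul_le_of_le_one_right (by positivity) ?_
        rw [inv_mul_le_iff₀ hEaR, mul_one]
        exact h1
      _ ≤ δ * κ x := by gcongr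
  · intro x hx
    rw [FK1]
    by_cases hxK : x ∈ K
    · rw [Set.indicator_of_mem hxK]
      have := hPψ x
      rw [add_mul] at this
      exact this
    · rw [Set.indicator_of_notMem hxK, add_zero]
      refine hR x ?_
      by_contra hcon
      exact hxK ⟨hx, by simpa using not_lt.1 hcon⟩
  · intro x _
    rw [FK1, hP, P_smul, ← hP]
    have h1 : P (fun y => θ₂ * K0.indicator (fun _ => (1:ℝ)) y) x ≤ P κ x := by
      refine H.P_mono ha.le (B := θ₂ * 1) ⟨?_, ?_, ?_⟩ hκg ?_ x
      · exact (hone K0 hK0m).m.const_mul _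
      · exact fun y => mul_nonneg hθ₂p.le ((hone K0 hK0m).nn y)
      · intro y
        rw [mul_assoc θ₂ 1]
        exact mul_le_mul_of_nonneg_left ((hone K0 hK0m).le y) hθ₂p.le
      · intro y _
        by_cases hy : y ∈ K0
        · rw [Set.indicator_of_mem hy, mul_one]; exact hκ0 y hy
        · rw [Set.indicator_of_notMem hy, mul_zero]; exact hκg.nn y
    rw [hP, P_smul, ← hP] at h1
    calc θ₂ * (δ * κ x) = δ * (θ₂ * κ x) := by ring
      _ ≤ δ * P κ x := mul_le_mul_of_nonneg_left h1 hδp.le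
  · intro n y hy z hz
    set Q := cH + A * θ₂ / (2 * κR) with hQ
    have hQp : 0 < Q := by positivity
    have hy1 := hψ1 y
    have hz1 := hψ1 z
    have hzR := hψR z hz
    obtain ⟨B, hB⟩ := hgood n
    change h n y * ψ z ≤ (1 + Q * Real.exp (a * R)) * h n z * ψ y
    have hnz := hB.nn z
    cases n with
    | zero =>
      change ψ y * ψ z ≤ (1 + Q * Real.exp (a * R)) * ψ z * ψ y
      have : 0 ≤ Q * Real.exp (a * R) * (ψ z * ψ y) := by positivity
      nlinarith
    | succ n =>
      have h1 := harnK n y hy z hz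
      calc h (n+1) y * ψ z ≤ (Q * h (n+1) z) * Real.exp (a * R) := by
            refine mul_le_mul h1 hzR (hψ.nn z) (by positivity)
        _ ≤ (1 + Q * Real.exp (a * R)) * h (n+1) z := by nlinarith
        _ ≤ (1 + Q * Real.exp (a * R)) * h (n+1) z * ψ y :=
            le_mul_of_one_le_right (by positivity) hy1
  · have : ∀ n, ∃ c > 0, ∀ x ∈ K, c ≤ FK Edom F G γ n (K.indicator ψ) x := by
      intro n
      induction n with
      | zero =>
        refine ⟨1, one_pos, fun x hx => ?_⟩
        rw [FK0, Set.indicator_of_mem hx]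
        exact hψ1 x
      | succ n ih =>
        obtain ⟨c, hc, hcx⟩ := ih
        obtain ⟨B, hB⟩ := goodFK n _ _ (hψ.indicator hKm)
        refine ⟨c * (c1 * vK), by positivity, fun x hx => ?_⟩
        have h1 : P (fun y => c * K.indicator (fun _ => (1:ℝ)) y) x ≤
            P (FK Edom F G γ n (K.indicator ψ)) x := by
          refine H.P_mono ha.le (B := c * 1) ⟨?_, ?_, ?_⟩ hB ?_ x
          · exact (hone K hKm).m.const_mul _
          · exact fun y => mul_nonneg hc.le ((hone K hKm).nn y)
          · intro y
            rw [mul_assoc]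
            exact mul_le_mul_of_nonneg_left ((hone K hKm).le y) hc.le
          · intro y _
            by_cases hy : y ∈ K
            · rw [Set.indicator_of_mem hy, mul_one]; exact hcx y hy
            · rw [Set.indicator_of_notMem hy, mul_zero]; exact hB.nn y
        rw [hP, P_smul, ← hP] at h1
        rw [FKs]
        exact (mul_le_mul_of_nonneg_left (hlow x (hKn x hx) K hKm le_rfl) hc.le).trans h1
    intro x hx
    refine ⟨0, fun n _ => ?_⟩
    obtain ⟨c, hc, hcx⟩ := this n
    exact hc.trans_le (hcx x hx)
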